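/- arXiv:2410.19159 — 5 statements merged into one kernel-verified Lean document; each statement's English description precedes it below -/
import Mathlib

section
/- Let F_A, F_B : ℝ^n → ℝ be twice continuously differentiable convex functions with associated sets A = {p | F_A(p) ≤ 1} and B = {p | F_B(p) ≤ 1}, where A is nonempty and there exists p with F_B(p) < 1. Assume A ∩ B = ∅. Suppose p⋆ ∈ ℝ^n and λ⋆ ∈ ℝ satisfy the KKT conditions: ∇F_A(p⋆) + λ⋆ ∇F_B(p⋆) = 0, λ⋆ (F_B(p⋆) − 1) = 0, λ⋆ ≥ 0, and F_B(p⋆) ≤ 1. Then: F_A(p⋆) > 1, λ⋆ > 0, ∇F_B(p⋆) ≠ 0, and F_B(p⋆) = 1. -/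
/-- First-order characterization of convexity: a convex function lies above its tangent plane. -/
theorem ConvexOn.add_inner_gradient_le {E : Type*} [NormedAddCommGroup E]
    [InnerProductSpace ℝ E] [CompleteSpace E] {f : E → ℝ} {x : E}
    (hf : ConvexOn ℝ Set.univ f) (hd : DifferentiableAt ℝ f x) (y : E) :
    f x + inner ℝ (gradient f x) (y - x) ≤ f y := by
  have hconv : ConvexOn ℝ Set.univ (f ∘ AffineMap.lineMap (k := ℝ) x y) :=
    hf.comp_affineMap (AffineMap.lineMap x y)
  have hderiv : HasDerivAt (f ∘ AffineMap.lineMap (k := ℝ) x y)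
      (inner ℝ (gradient f x) (y - x)) 0 := by
    have hgrad : HasFDerivAt f (InnerProductSpace.toDual ℝ E (gradient f x))
        (AffineMap.lineMap x y (0 : ℝ)) := by
      simpa using hd.hasGradientAt.hasFDerivAt
    simpa using hgrad.comp_hasDerivAt (0 : ℝ) AffineMap.hasDerivAt_lineMap
  have hslope := hconv.le_slope_of_hasDerivAt (Set.mem_univ 0) (Set.mem_univ 1)
    zero_lt_one hderiv
  simp only [slope_def_field, Function.comp_apply, AffineMap.lineMap_apply_zero,
    AffineMap.lineMap_apply_one, sub_zero, div_one] at hslope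
  linarith

/-- A zero of the gradient of a convex function is a global minimizer. -/
theorem ConvexOn.le_of_gradient_eq_zero {E : Type*} [NormedAddCommGroup E]
    [InnerProductSpace ℝ E] [CompleteSpace E] {f : E → ℝ} {x : E}
    (hf : ConvexOn ℝ Set.univ f) (hd : DifferentiableAt ℝ f x) (hx : gradient f x = 0) (y : E) :
    f x ≤ f y := by
  simpa [hx] using hf.add_inner_gradient_le hd y

/-- Properties of KKT points of the scaling-factor problem
`min F_A(p)` subject to `F_B(p) ≤ 1` when the sets `A` and `B` are disjoint. -/
theorem stmt_1 {n : ℕ} (FA FB : EuclideanSpace ℝ (Fin n) → ℝ)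
    (hFA : ContDiff ℝ 2 FA) (hFB : ContDiff ℝ 2 FB)
    (hconvA : ConvexOn ℝ Set.univ FA) (hconvB : ConvexOn ℝ Set.univ FB)
    (hA : ∃ p, FA p ≤ 1) (hB : ∃ p, FB p < 1)
    (hdisj : ∀ p, ¬(FA p ≤ 1 ∧ FB p ≤ 1))
    (pstar : EuclideanSpace ℝ (Fin n)) (lam : ℝ)
    (hstat : gradient FA pstar + lam • gradient FB pstar = 0)
    (hcomp : lam * (FB pstar - 1) = 0)
    (hdualpos : 0 ≤ lam)
    (hfeas : FB pstar ≤ 1) :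
    1 < FA pstar ∧ 0 < lam ∧ gradient FB pstar ≠ 0 ∧ FB pstar = 1 := by
  have hlt : 1 < FA pstar := lt_of_not_ge fun h => hdisj pstar ⟨h, hfeas⟩
  have hgradA : gradient FA pstar ≠ 0 := fun h => by
    obtain ⟨a, ha⟩ := hA
    have hle := hconvA.le_of_gradient_eq_zero
      (hFA.differentiable two_ne_zero).differentiableAt h a
    linarith
  have hlam : lam ≠ 0 := fun h => hgradA (by simpa [h] using hstat)
  refine ⟨hlt, hdualpos.lt_of_ne' hlam, fun h => hgradA (by simpa [h] using hstat), ?_⟩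
  exact sub_eq_zero.mp ((mul_eq_zero.mp hcomp).resolve_left hlam)
end

section
/- Let F_A, F_B : ℝ^n → ℝ be twice continuously differentiable convex functions with associated sets A = {p | F_A(p) ≤ 1} and B = {p | F_B(p) ≤ 1}, where A is nonempty, there exists p with F_B(p) < 1, and A ∩ B = ∅. If at least one of F_A and F_B is strictly convex, then the minimizer of F_A over the feasible set {p | F_B(p) ≤ 1} is unique: any two points p₁, p₂ that are feasible and attain the minimal value of F_A over {p | F_B(p) ≤ 1} satisfy p₁ = p₂. -/
/-- A minimizer of a convex function `f` over the sublevel set `{x | g x ≤ c}` of a convex function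
`g` makes the constraint active as soon as `f` takes a smaller value somewhere. -/
theorem ConvexOn.le_of_forall_sublevel_le {E : Type*} [AddCommGroup E] [Module ℝ E]
    {f g : E → ℝ} (hf : ConvexOn ℝ Set.univ f) (hg : ConvexOn ℝ Set.univ g) {c : ℝ} {m a : E}
    (hmin : ∀ x, g x ≤ c → f m ≤ f x) (ha : f a < f m) : c ≤ g m := by
  by_contra! hm
  have hga : c < g a := by
    by_contra! h
    exact (hmin a h).not_gt ha
  have hpos : 0 < g a - g m := by linarith
  set t := (c - g m) / (g a - g m)
  have ht0 : 0 < t := div_pos (by linarith) hpos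
  have ht1 : t < 1 := (div_lt_one hpos).2 (by linarith)
  have htc : t * (g a - g m) = c - g m := div_mul_cancel₀ _ hpos.ne'
  have hfx := hf.2 (Set.mem_univ m) (Set.mem_univ a) (sub_nonneg.2 ht1.le) ht0.le (by ring)
  have hgx := hg.2 (Set.mem_univ m) (Set.mem_univ a) (sub_nonneg.2 ht1.le) ht0.le (by ring)
  simp only [smul_eq_mul] at hfx hgx
  have := hmin _ (hgx.trans (by linarith))
  nlinarith

/-- Uniqueness of the minimizer of `F_A` over `{p | F_B p ≤ 1}`
when the sets are disjoint and at least one scaling function is strictly convex. -/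
theorem stmt_2 {n : ℕ} (FA FB : EuclideanSpace ℝ (Fin n) → ℝ)
    (hFA : ContDiff ℝ 2 FA) (hFB : ContDiff ℝ 2 FB)
    (hconvA : ConvexOn ℝ Set.univ FA) (hconvB : ConvexOn ℝ Set.univ FB)
    (hA : ∃ p, FA p ≤ 1) (hB : ∃ p, FB p < 1)
    (hdisj : ∀ p, ¬(FA p ≤ 1 ∧ FB p ≤ 1))
    (hstrict : StrictConvexOn ℝ Set.univ FA ∨ StrictConvexOn ℝ Set.univ FB)
    (p₁ p₂ : EuclideanSpace ℝ (Fin n))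
    (hfeas₁ : FB p₁ ≤ 1) (hfeas₂ : FB p₂ ≤ 1)
    (hmin₁ : ∀ p, FB p ≤ 1 → FA p₁ ≤ FA p)
    (hmin₂ : ∀ p, FB p ≤ 1 → FA p₂ ≤ FA p) :
    p₁ = p₂ := by
  rcases hstrict with hs | hs
  · exact (hs.subset (Set.subset_univ _)
      (by simpa using hconvB.convex_le 1)).eq_of_isMinOn (s := {p | FB p ≤ 1})
      hmin₁ hmin₂ hfeas₁ hfeas₂
  · by_contra hne
    obtain ⟨a, ha⟩ := hA
    have half : (0 : ℝ) < 1 / 2 := by norm_num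
    have hBm := hs.2 (Set.mem_univ p₁) (Set.mem_univ p₂) hne half half (by norm_num)
    have hAm := hconvA.2 (Set.mem_univ p₁) (Set.mem_univ p₂) half.le half.le (by norm_num)
    simp only [smul_eq_mul] at hBm hAm
    have h₂₁ := hmin₂ p₁ hfeas₁
    have h₁ : 1 < FA p₁ := by
      by_contra! h
      exact hdisj p₁ ⟨h, hfeas₁⟩
    have hm := hmin₁ _ (hBm.le.trans (by linarith))
    have hactive := hconvA.le_of_forall_sublevel_le hconvB
      (fun x hx => hAm.trans (by linarith [hmin₁ x hx])) (ha.trans_lt (h₁.trans_le hm))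
    linarith
end

section
/- Let F_A, F_B : ℝ^n × ℝ^m → ℝ be twice continuously differentiable functions such that for each parameter θ ∈ ℝ^m: p ↦ F_A(p, θ) and p ↦ F_B(p, θ) are convex; the set {p | F_A(p, θ) ≤ 1} is nonempty; there exists p with F_B(p, θ) < 1; the sets {p | F_A(p, θ) ≤ 1} and {p | F_B(p, θ) ≤ 1} are disjoint; at least one of p ↦ F_A(p, θ) and p ↦ F_B(p, θ) has an everywhere positive definite Hessian in p; and the minimum of p ↦ F_A(p, θ) over {p | F_B(p, θ) ≤ 1} is attained. Then the optimal-value function α⋆(θ) = min { F_A(p, θ) | F_B(p, θ) ≤ 1 } is continuously differentiable (of class C¹) in θ on ℝ^m. -/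
open Set Filter Topology Asymptotics

section Convexity

variable {E : Type*} [NormedAddCommGroup E] [NormedSpace ℝ E]

/-- A convex function lies above its tangent hyperplanes. -/
theorem ConvexOn.add_fderiv_sub_le {f : E → ℝ} (hf : ConvexOn ℝ univ f) {f' : E →L[ℝ] ℝ} {x : E}
    (hx : HasFDerivAt f f' x) (y : E) : f x + f' (y - x) ≤ f y := by
  have hconv : ConvexOn ℝ univ (f ∘ AffineMap.lineMap (k := ℝ) x y) := by
    simpa using hf.comp_affineMap (AffineMap.lineMap (k := ℝ) x y)
  have hderiv : HasDerivAt (f ∘ AffineMap.lineMap (k := ℝ) x y) (f' (y - x)) 0 := by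
    apply HasFDerivAt.comp_hasDerivAt
    · simpa using hx
    · exact AffineMap.hasDerivAt_lineMap
  have h := hconv.le_slope_of_hasDerivAt (mem_univ 0) (mem_univ 1) one_pos hderiv
  simp [slope_def_field] at h
  rw [map_sub]
  linarith

/-- A `C²` function with an everywhere positive definite Hessian is strictly convex. -/
theorem strictConvexOn_univ_of_iteratedFDeriv_two_pos {f : E → ℝ} (hf : ContDiff ℝ 2 f)
    (hpos : ∀ x v, v ≠ 0 → 0 < iteratedFDeriv ℝ 2 f x ![v, v]) :
    StrictConvexOn ℝ univ f := by
  refine ⟨convex_univ, fun x _ y _ hxy a b ha hb hab => ?_⟩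
  have hline (t : ℝ) : HasDerivAt (AffineMap.lineMap (k := ℝ) x y) (y - x) t :=
    AffineMap.hasDerivAt_lineMap
  have hdf : Differentiable ℝ f := hf.differentiable (by norm_num)
  have hd2f : Differentiable ℝ (fderiv ℝ f) :=
    (hf.fderiv_right (m := 1) (by norm_num)).differentiable (by norm_num)
  have hderiv : deriv (f ∘ AffineMap.lineMap (k := ℝ) x y) =
      fun t => fderiv ℝ f (AffineMap.lineMap x y t) (y - x) :=
    funext fun t => ((hdf _).hasFDerivAt.comp_hasDerivAt t (hline t)).deriv
  have hstrict : StrictConvexOn ℝ univ (f ∘ AffineMap.lineMap (k := ℝ) x y) := by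
    refine strictConvexOn_univ_of_deriv2_pos
      (hdf.continuous.comp AffineMap.lineMap_continuous) fun t => ?_
    have h2 := ((hd2f _).hasFDerivAt.comp_hasDerivAt t (hline t)).clm_apply
      (hasDerivAt_const t (y - x))
    have h2' : deriv (fun t => fderiv ℝ f (AffineMap.lineMap x y t) (y - x)) t = _ := h2.deriv
    have h := hpos (AffineMap.lineMap x y t) (y - x) (sub_ne_zero.2 hxy.symm)
    rw [iteratedFDeriv_two_apply] at h
    rw [Function.iterate_succ, Function.iterate_one, Function.comp_apply, hderiv, h2']
    simpa using h
  have h := hstrict.2 (mem_univ 0) (mem_univ 1) zero_ne_one ha hb hab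
  have hb' : AffineMap.lineMap x y b = a • x + b • y := by
    rw [AffineMap.lineMap_apply_module, ← hab, add_sub_cancel_right]
  simpa [hb'] using h

end Convexity

section ConvexProgram

variable {E : Type*} [NormedAddCommGroup E] [NormedSpace ℝ E]

/-- If the constraint is inactive at a constrained minimizer of a convex function, then the
minimizer is a global one. -/
theorem IsMinOn.le_of_lt_of_convexOn {f g : E → ℝ} {c : ℝ} {p : E} (hf : ConvexOn ℝ univ f)
    (hg : Continuous g) (hmin : IsMinOn f {x | g x ≤ c} p) (hp : g p < c) (x : E) :
    f p ≤ f x := by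
  refine IsMinOn.of_isLocalMin_of_convex_univ ?_ hf x
  filter_upwards [hg.continuousAt.eventually_lt continuousAt_const hp] with y hy
  exact hmin (show g y ≤ c from hy.le)

/-- Minimizers of a convex program are unique when the objective or the constraint function is
strictly convex, provided that the constraint is active at all minimizers. -/
theorem IsMinOn.eq_of_strictConvexOn {f g : E → ℝ} {c : ℝ} {p q : E}
    (hf : ConvexOn ℝ univ f) (hgconv : ConvexOn ℝ univ g)
    (hstrict : StrictConvexOn ℝ univ f ∨ StrictConvexOn ℝ univ g)
    (hactive : ∀ x, IsMinOn f {x | g x ≤ c} x → c ≤ g x)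
    (hpc : g p ≤ c) (hp : IsMinOn f {x | g x ≤ c} p)
    (hqc : g q ≤ c) (hq : IsMinOn f {x | g x ≤ c} q) : p = q := by
  by_contra hpq
  set m : E := (1 / 2 : ℝ) • p + (1 / 2 : ℝ) • q
  have hfpq : f q ≤ f p := hq hpc
  have hmf : f m ≤ (1 / 2 : ℝ) • f p + (1 / 2 : ℝ) • f q :=
    hf.2 (mem_univ p) (mem_univ q) (by norm_num) (by norm_num) (by norm_num)
  have hmg : g m ≤ (1 / 2 : ℝ) • g p + (1 / 2 : ℝ) • g q :=
    hgconv.2 (mem_univ p) (mem_univ q) (by norm_num) (by norm_num) (by norm_num)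
  simp only [smul_eq_mul] at hmf hmg
  have hmc : g m ≤ c := by linarith
  rcases hstrict with h | h
  · have hlt : f m < (1 / 2 : ℝ) • f p + (1 / 2 : ℝ) • f q :=
      h.2 (mem_univ p) (mem_univ q) hpq (by norm_num) (by norm_num) (by norm_num)
    have hle : f p ≤ f m := hp hmc
    simp only [smul_eq_mul] at hlt
    linarith
  · have hlt : g m < (1 / 2 : ℝ) • g p + (1 / 2 : ℝ) • g q :=
      h.2 (mem_univ p) (mem_univ q) hpq (by norm_num) (by norm_num) (by norm_num)
    simp only [smul_eq_mul] at hlt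
    have hcm : c ≤ g m := hactive m fun x hx => by
      have h1 : f p ≤ f x := hp hx
      show f m ≤ f x
      linarith
    linarith

/-- Every direction along which the active constraint decreases is an ascent direction of the
objective at a constrained minimizer. -/
theorem IsMinOn.hasFDerivAt_nonneg {f g : E → ℝ} {f' g' : E →L[ℝ] ℝ} {c : ℝ} {p v : E}
    (hf : HasFDerivAt f f' p) (hg : HasFDerivAt g g' p) (hpc : g p = c)
    (hmin : IsMinOn f {x | g x ≤ c} p) (hv : g' v < 0) : 0 ≤ f' v := by
  have hline : HasDerivAt (fun t : ℝ => p + t • v) v 0 := by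
    simpa using ((hasDerivAt_id (0 : ℝ)).smul_const v).const_add p
  have hfl : HasDerivAt (fun t : ℝ => f (p + t • v)) (f' v) 0 :=
    HasFDerivAt.comp_hasDerivAt (l := f) (l' := f') 0 (by simpa using hf) hline
  have hgl : HasDerivAt (fun t : ℝ => g (p + t • v)) (g' v) 0 :=
    HasFDerivAt.comp_hasDerivAt (l := g) (l' := g') 0 (by simpa using hg) hline
  have hfs := hfl.tendsto_slope_zero_right
  have hgs := hgl.tendsto_slope_zero_right
  refine ge_of_tendsto hfs ?_
  filter_upwards [hgs.eventually_lt_const hv, self_mem_nhdsWithin] with t ht ht0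
  have ht0 : 0 < t := ht0
  simp only [zero_add, zero_smul, add_zero, smul_eq_mul] at ht ⊢
  have hneg : g (p + t • v) - g p < 0 := by
    by_contra! h
    exact absurd ht (not_lt.2 (mul_nonneg (inv_nonneg.2 ht0.le) h))
  have : f p ≤ f (p + t • v) := hmin (show g (p + t • v) ≤ c by linarith)
  exact mul_nonneg (inv_nonneg.2 ht0.le) (by linarith)

/-- Lagrange multiplier for a single active inequality constraint. -/
theorem IsMinOn.exists_lagrange_multiplier {f g : E → ℝ} {f' g' : E →L[ℝ] ℝ} {c : ℝ} {p w : E}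
    (hf : HasFDerivAt f f' p) (hg : HasFDerivAt g g' p) (hpc : g p = c)
    (hmin : IsMinOn f {x | g x ≤ c} p) (hw : g' w < 0) :
    ∃ l : ℝ, 0 ≤ l ∧ f' + l • g' = 0 := by
  have key (v : E) (hv : g' v = 0) : 0 ≤ f' v := by
    have hlim : Tendsto (fun t : ℝ => f' v + t * f' w) (𝓝[>] 0) (𝓝 (f' v)) := by
      have : ContinuousAt (fun t : ℝ => f' v + t * f' w) 0 := by fun_prop
      simpa using this.tendsto.mono_left nhdsWithin_le_nhds
    refine ge_of_tendsto hlim ?_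
    filter_upwards [self_mem_nhdsWithin] with t ht
    have := IsMinOn.hasFDerivAt_nonneg (v := v + t • w) hf hg hpc hmin
      (by simpa [hv] using mul_neg_of_pos_of_neg (show 0 < t from ht) hw)
    simpa using this
  refine ⟨-(f' w / g' w), ?_, ?_⟩
  · rw [neg_nonneg]
    exact div_nonpos_of_nonneg_of_nonpos (IsMinOn.hasFDerivAt_nonneg hf hg hpc hmin hw) hw.le
  · ext v
    have hv : g' (v - (g' v / g' w) • w) = 0 := by
      simp [div_mul_cancel₀ _ hw.ne]
    have h1 := key _ hv
    have h2 := key (-(v - (g' v / g' w) • w)) (by rw [map_neg, hv, neg_zero])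
    rw [map_neg] at h2
    have h3 : f' (v - (g' v / g' w) • w) = 0 := by linarith
    simp only [map_sub, map_smul, smul_eq_mul] at h3
    simp only [add_apply, smul_apply, smul_eq_mul,
      zero_apply]
    rw [← h3]
    ring

end ConvexProgram

section ParametricProgram

variable {E T : Type*} [NormedAddCommGroup E] [NormedSpace ℝ E]

/-- The minimizer of a parametric convex program depends continuously on the parameter wherever it
is unique and Slater's condition holds. -/
theorem continuousAt_of_isMinOn_of_convexOn [ProperSpace E] [TopologicalSpace T]
    {f g : E × T → ℝ} {c : ℝ}
    (hf : Continuous f) (hg : Continuous g) (hfconv : ∀ t, ConvexOn ℝ univ fun x => f (x, t))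
    (hgconv : ∀ t, ConvexOn ℝ univ fun x => g (x, t)) {p : T → E} (hpc : ∀ t, g (p t, t) ≤ c)
    (hmin : ∀ t, IsMinOn (fun x => f (x, t)) {x | g (x, t) ≤ c} (p t)) {t₀ : T}
    (hslater : ∃ x, g (x, t₀) < c)
    (huniq : ∀ q, g (q, t₀) ≤ c → IsMinOn (fun x => f (x, t₀)) {x | g (x, t₀) ≤ c} q → q = p t₀) :
    ContinuousAt p t₀ := by
  rw [ContinuousAt, Metric.tendsto_nhds]
  intro r hr
  obtain ⟨β, hβ, hβK⟩ : ∃ β, f (p t₀, t₀) < β ∧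
      ∀ q ∈ Metric.sphere (p t₀) r ∩ {x | g (x, t₀) ≤ c}, β ≤ f (q, t₀) := by
    have hK : IsCompact (Metric.sphere (p t₀) r ∩ {x | g (x, t₀) ≤ c}) :=
      (isCompact_sphere _ _).inter_right (isClosed_le (by fun_prop) continuous_const)
    rcases (Metric.sphere (p t₀) r ∩ {x | g (x, t₀) ≤ c}).eq_empty_or_nonempty with h | h
    · exact ⟨f (p t₀, t₀) + 1, by linarith, by simp [h]⟩
    · obtain ⟨q, hq, hqmin⟩ := hK.exists_isMinOn h (f := fun x => f (x, t₀)) (by fun_prop)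
      refine ⟨f (q, t₀), ?_, fun x hx => hqmin hx⟩
      by_contra! hle
      have hqp : q = p t₀ := huniq q hq.2 fun x hx => hle.trans (hmin t₀ hx)
      have hqr := hq.1
      rw [hqp, Metric.mem_sphere, dist_self] at hqr
      exact hr.ne hqr
  obtain ⟨s, hsc, hsβ, hsr⟩ : ∃ s, g (s, t₀) < c ∧ f (s, t₀) < β ∧ dist s (p t₀) < r := by
    obtain ⟨z, hz⟩ := hslater
    have hline : Continuous (AffineMap.lineMap (k := ℝ) (p t₀) z) := AffineMap.lineMap_continuous
    have h1 : ∀ᶠ a : ℝ in 𝓝[>] 0, f (AffineMap.lineMap (p t₀) z a, t₀) < β := by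
      have : ContinuousAt (fun a : ℝ => f (AffineMap.lineMap (p t₀) z a, t₀)) 0 := by fun_prop
      exact (this.eventually_lt continuousAt_const (by simpa using hβ)).filter_mono
        nhdsWithin_le_nhds
    have h2 : ∀ᶠ a : ℝ in 𝓝[>] 0, dist (AffineMap.lineMap (p t₀) z a) (p t₀) < r := by
      have : ContinuousAt (fun a : ℝ => dist (AffineMap.lineMap (p t₀) z a) (p t₀)) 0 := by
        fun_prop
      exact (this.eventually_lt continuousAt_const (by simpa using hr)).filter_mono
        nhdsWithin_le_nhds
    have h3 : ∀ᶠ a : ℝ in 𝓝[>] 0, a ∈ Ioo (0 : ℝ) 1 := Ioo_mem_nhdsGT one_pos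
    obtain ⟨a, ha1, ha2, ha3⟩ := (h1.and (h2.and h3)).exists
    refine ⟨_, ?_, ha1, ha2⟩
    have h := (hgconv t₀).2 (mem_univ (p t₀)) (mem_univ z) (sub_nonneg.2 ha3.2.le) ha3.1.le
      (sub_add_cancel 1 a)
    rw [← AffineMap.lineMap_apply_module] at h
    simp only [smul_eq_mul] at h
    nlinarith [hpc t₀, ha3.1, ha3.2]
  have hsphere : ∀ᶠ t in 𝓝 t₀, ∀ q ∈ Metric.sphere (p t₀) r,
      c < g (q, t) ∨ f (s, t) < f (q, t) := by
    refine (isCompact_sphere (p t₀) r).eventually_forall_of_forall_eventually fun q hq => ?_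
    have hopen : IsOpen {z : T × E | c < g (z.2, z.1) ∨ f (s, z.1) < f (z.2, z.1)} :=
      (isOpen_lt (f := fun _ => c) (g := fun z : T × E => g (z.2, z.1)) (by fun_prop)
        (by fun_prop)).union
        (isOpen_lt (f := fun z : T × E => f (s, z.1)) (g := fun z : T × E => f (z.2, z.1))
          (by fun_prop) (by fun_prop))
    refine hopen.mem_nhds ?_
    by_cases hqc : g (q, t₀) ≤ c
    · exact Or.inr (hsβ.trans_le (hβK q ⟨hq, hqc⟩))
    · exact Or.inl (not_le.1 hqc)
  have hsfeas : ∀ᶠ t in 𝓝 t₀, g (s, t) < c := by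
    have : ContinuousAt (fun t => g (s, t)) t₀ := by fun_prop
    exact this.eventually_lt continuousAt_const hsc
  filter_upwards [hsphere, hsfeas] with t ht hst
  by_contra! hfar
  obtain ⟨a, ha, haq⟩ : r ∈ (fun a : ℝ => dist (AffineMap.lineMap s (p t) a) (p t₀)) ''
      Icc 0 1 := by
    have hline : Continuous (AffineMap.lineMap (k := ℝ) s (p t)) := AffineMap.lineMap_continuous
    refine intermediate_value_Icc zero_le_one (by fun_prop) ?_
    simpa using ⟨hsr.le, hfar⟩
  have hseg : AffineMap.lineMap s (p t) a ∈ segment ℝ s (p t) := by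
    rw [segment_eq_image_lineMap]
    exact mem_image_of_mem _ ha
  have hgq := (hgconv t).le_max_of_mem_segment (mem_univ s) (mem_univ (p t)) hseg
  have hfq := (hfconv t).le_max_of_mem_segment (mem_univ s) (mem_univ (p t)) hseg
  have hps : f (p t, t) ≤ f (s, t) := hmin t hst.le
  rcases ht _ haq with h | h
  · exact absurd h (not_lt.2 (hgq.trans (max_le hst.le (hpc t))))
  · exact absurd h (not_lt.2 (hfq.trans (max_le le_rfl hps)))

variable [NormedAddCommGroup T] [NormedSpace ℝ T]

/-- First-order expansion in the second variable, uniform with respect to a continuous choice of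
the first variable and of a scalar factor. -/
theorem HasStrictFDerivAt.isLittleO_mul_sub_snd {F : E × T → ℝ} {F' : E × T →L[ℝ] ℝ} {t₀ : T}
    {q : T → E} {k : T → ℝ} {x₀ : E} {k₀ : ℝ} (hF : HasStrictFDerivAt F F' (x₀, t₀))
    (hq : Tendsto q (𝓝 t₀) (𝓝 x₀)) (hk : Tendsto k (𝓝 t₀) (𝓝 k₀)) :
    (fun t => k t * (F (q t, t) - F (q t, t₀)) - k₀ * F' (0, t - t₀)) =o[𝓝 t₀]
      fun t => t - t₀ := by
  have hexp : (fun t => F (q t, t) - F (q t, t₀) - F' (0, t - t₀)) =o[𝓝 t₀] fun t => t - t₀ := by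
    have htend : Tendsto (fun t => ((q t, t), (q t, t₀))) (𝓝 t₀) (𝓝 ((x₀, t₀), (x₀, t₀))) :=
      (hq.prodMk_nhds tendsto_id).prodMk_nhds (hq.prodMk_nhds tendsto_const_nhds)
    have h := hF.isLittleO.comp_tendsto htend
    refine ((h.congr (g₂ := fun t => ((0 : E), t - t₀)) ?_ ?_)).trans_isBigO ?_
    · exact fun t => by simp only [Function.comp_apply, Prod.mk_sub_mk, sub_self]
    · exact fun t => by simp only [Function.comp_apply, Prod.mk_sub_mk, sub_self]
    · exact IsBigO.of_bound 1 (by simp [Prod.norm_def])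
  have hlin : (fun t => F' (0, t - t₀)) =O[𝓝 t₀] fun t => t - t₀ :=
    (F'.comp (ContinuousLinearMap.inr ℝ E T)).isBigO_comp (fun t => t - t₀) (𝓝 t₀) |>.congr_left
      (by simp)
  have h1 : (fun t => k t * (F (q t, t) - F (q t, t₀) - F' (0, t - t₀))) =o[𝓝 t₀]
      fun t => t - t₀ := by
    exact (((hk.isBigO_one ℝ).mul_isLittleO hexp.norm_right).congr_right (by simp)).of_norm_right
  have h2 : (fun t => (k t - k₀) * F' (0, t - t₀)) =o[𝓝 t₀] fun t => t - t₀ := by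
    have hk0 : (fun t => k t - k₀) =o[𝓝 t₀] fun _ => (1 : ℝ) := by
      rw [isLittleO_one_iff]
      simpa using hk.sub_const k₀
    exact ((hk0.mul_isBigO hlin.norm_right).congr_right (by simp)).of_norm_right
  exact (h1.add h2).congr_left fun t => by ring

/-- Envelope theorem for a family of convex programs with one active constraint. -/
theorem hasFDerivAt_of_lagrangian {f g : E × T → ℝ} {f' g' : E × T →L[ℝ] ℝ} {c : ℝ} {p : T → E}
    {l : T → ℝ} {t₀ : T} (hf : HasStrictFDerivAt f f' (p t₀, t₀))
    (hg : HasStrictFDerivAt g g' (p t₀, t₀)) (hp : ContinuousAt p t₀) (hl : ContinuousAt l t₀)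
    (hpc : ∀ t, g (p t, t) = c)
    (hlag : ∀ t x, f (p t, t) + l t * g (p t, t) ≤ f (x, t) + l t * g (x, t)) :
    HasFDerivAt (fun t => f (p t, t))
      ((f' + l t₀ • g').comp (ContinuousLinearMap.inr ℝ E T)) t₀ := by
  have hupper := (hf.isLittleO_mul_sub_snd (q := fun _ => p t₀) tendsto_const_nhds
    (tendsto_const_nhds (x := (1 : ℝ)))).add
    (hg.isLittleO_mul_sub_snd (q := fun _ => p t₀) tendsto_const_nhds hl)
  have hlower := (hf.isLittleO_mul_sub_snd hp (tendsto_const_nhds (x := (1 : ℝ)))).add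
    (hg.isLittleO_mul_sub_snd hp (tendsto_const_nhds (x := l t₀)))
  refine .of_isLittleO (IsBigO.trans_isLittleO (IsBigO.of_bound 1 (.of_forall fun t => ?_))
    (hupper.norm_left.add hlower.norm_left))
  have h1 := hlag t (p t₀)
  have h2 := hlag t₀ (p t)
  have e0 := hpc t₀
  have e1 := hpc t
  rw [one_mul, Real.norm_eq_abs, Real.norm_eq_abs, Real.norm_eq_abs, Real.norm_eq_abs]
  simp only [ContinuousLinearMap.comp_apply, ContinuousLinearMap.inr_apply,
    add_apply, smul_apply, smul_eq_mul]
  refine le_trans ?_ (le_abs_self _)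
  rw [abs_le]
  rw [e1] at h1
  rw [e0] at h2
  rw [e0, e1]
  constructor
  · refine le_trans ?_ (sub_le_sub_right (show l t₀ * (c - g (p t, t₀)) +
      (f (p t, t) - f (p t, t₀)) ≤ f (p t, t) - f (p t₀, t₀) by linarith) _)
    refine le_trans (neg_le_neg (le_add_of_nonneg_left (abs_nonneg _))) ?_
    refine (neg_abs_le _).trans (le_of_eq (by ring))
  · refine le_trans (sub_le_sub_right (show f (p t, t) - f (p t₀, t₀) ≤
      (f (p t₀, t) - f (p t₀, t₀)) + l t * (g (p t₀, t) - c) by linarith) _) ?_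
    refine le_trans ?_ (le_add_of_nonneg_right (abs_nonneg _))
    refine le_trans (le_of_eq (by ring)) (le_abs_self _)

end ParametricProgram

/-- The minimal scaling factor `α⋆(θ)` is continuously
differentiable in the parameter `θ` when the scaling functions are C²,
the sets are disjoint, and one of them has a positive definite Hessian. -/
theorem stmt_3 {n m : ℕ}
    (FA FB : EuclideanSpace ℝ (Fin n) × EuclideanSpace ℝ (Fin m) → ℝ)
    (hFA : ContDiff ℝ 2 FA) (hFB : ContDiff ℝ 2 FB)
    (hconvA : ∀ θ, ConvexOn ℝ Set.univ (fun p => FA (p, θ)))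
    (hconvB : ∀ θ, ConvexOn ℝ Set.univ (fun p => FB (p, θ)))
    (hAne : ∀ θ, ∃ p, FA (p, θ) ≤ 1)
    (hSlater : ∀ θ, ∃ p, FB (p, θ) < 1)
    (hdisj : ∀ θ p, ¬(FA (p, θ) ≤ 1 ∧ FB (p, θ) ≤ 1))
    (hHess : ∀ θ,
      (∀ p v, v ≠ 0 → 0 < iteratedFDeriv ℝ 2 (fun p' => FA (p', θ)) p ![v, v]) ∨
      (∀ p v, v ≠ 0 → 0 < iteratedFDeriv ℝ 2 (fun p' => FB (p', θ)) p ![v, v]))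
    (hattain : ∀ θ, ∃ p, FB (p, θ) ≤ 1 ∧
      ∀ p', FB (p', θ) ≤ 1 → FA (p, θ) ≤ FA (p', θ)) :
    ContDiff ℝ 1 (fun θ => sInf ((fun p => FA (p, θ)) '' {p | FB (p, θ) ≤ 1})) := by
  have hdA : ∀ z, HasStrictFDerivAt FA (fderiv ℝ FA z) z := fun z =>
    hFA.contDiffAt.hasStrictFDerivAt (by norm_num)
  have hdB : ∀ z, HasStrictFDerivAt FB (fderiv ℝ FB z) z := fun z =>
    hFB.contDiffAt.hasStrictFDerivAt (by norm_num)
  have hcA : Continuous FA := hFA.continuous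
  have hcB : Continuous FB := hFB.continuous
  have hpartial (F : EuclideanSpace ℝ (Fin n) × EuclideanSpace ℝ (Fin m) → ℝ)
      (hF : ∀ z, HasStrictFDerivAt F (fderiv ℝ F z) z) (x : EuclideanSpace ℝ (Fin n))
      (θ : EuclideanSpace ℝ (Fin m)) :
      HasFDerivAt (fun x' => F (x', θ))
        ((fderiv ℝ F (x, θ)).comp (ContinuousLinearMap.inl ℝ _ _)) x :=
    (hF (x, θ)).hasFDerivAt.comp x (hasFDerivAt_prodMk_left x θ)
  choose p hpc hpmin using hattain
  have hmin : ∀ θ, IsMinOn (fun x => FA (x, θ)) {x | FB (x, θ) ≤ 1} (p θ) := fun θ x hx =>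
    hpmin θ x hx
  have hactive (θ) (x) (hx : IsMinOn (fun x => FA (x, θ)) {x | FB (x, θ) ≤ 1} x) :
      1 ≤ FB (x, θ) := by
    by_contra! hlt
    obtain ⟨a, ha⟩ := hAne θ
    have := hx.le_of_lt_of_convexOn (hconvA θ) (g := fun x => FB (x, θ)) (by fun_prop) hlt a
    exact hdisj θ x ⟨this.trans ha, hlt.le⟩
  have hpeq : ∀ θ, FB (p θ, θ) = 1 := fun θ => (hpc θ).antisymm (hactive θ _ (hmin θ))
  have hstrict (θ) : StrictConvexOn ℝ Set.univ (fun x => FA (x, θ)) ∨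
      StrictConvexOn ℝ Set.univ (fun x => FB (x, θ)) :=
    (hHess θ).imp
      (strictConvexOn_univ_of_iteratedFDeriv_two_pos (hFA.comp (contDiff_prodMk_left θ)))
      (strictConvexOn_univ_of_iteratedFDeriv_two_pos (hFB.comp (contDiff_prodMk_left θ)))
  have hpcont : Continuous p := continuous_iff_continuousAt.2 fun θ =>
    continuousAt_of_isMinOn_of_convexOn hcA hcB hconvA hconvB hpc hmin (hSlater θ)
      fun q hqc hq => hq.eq_of_strictConvexOn (hconvA θ) (hconvB θ) (hstrict θ) (hactive θ)
        hqc (hpc θ) (hmin θ)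
  choose s hs using hSlater
  have hdescent (θ) : fderiv ℝ FB (p θ, θ) (s θ - p θ, 0) < 0 := by
    have h := (hconvB θ).add_fderiv_sub_le (hpartial FB hdB (p θ) θ) (s θ)
    simp only [ContinuousLinearMap.comp_apply, ContinuousLinearMap.inl_apply] at h
    linarith [hs θ, hpeq θ]
  have hkkt (θ) := (hmin θ).exists_lagrange_multiplier (hpartial FA hdA (p θ) θ)
    (hpartial FB hdB (p θ) θ) (hpeq θ) (w := s θ - p θ) (by simpa using hdescent θ)
  choose l hl0 hl using hkkt
  have hlv (θ v) : fderiv ℝ FA (p θ, θ) (v, 0) + l θ * fderiv ℝ FB (p θ, θ) (v, 0) = 0 := by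
    simpa using DFunLike.congr_fun (hl θ) v
  have hA' : Continuous fun θ => fderiv ℝ FA (p θ, θ) :=
    (hFA.continuous_fderiv (by norm_num)).comp (hpcont.prodMk continuous_id)
  have hB' : Continuous fun θ => fderiv ℝ FB (p θ, θ) :=
    (hFB.continuous_fderiv (by norm_num)).comp (hpcont.prodMk continuous_id)
  have hlcont : Continuous l := by
    refine continuous_iff_continuousAt.2 fun θ₀ => ?_
    set w := s θ₀ - p θ₀
    have hAw : Continuous fun θ => fderiv ℝ FA (p θ, θ) (w, 0) := hA'.clm_apply continuous_const
    have hBw : Continuous fun θ => fderiv ℝ FB (p θ, θ) (w, 0) := hB'.clm_apply continuous_const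
    refine (hAw.neg.continuousAt.div hBw.continuousAt (hdescent θ₀).ne).congr ?_
    filter_upwards [hBw.continuousAt.eventually_ne (hdescent θ₀).ne] with θ hθ
    simp only [Pi.div_apply, Pi.neg_apply]
    rw [div_eq_iff hθ]
    linarith [hlv θ w]
  have hvalue : (fun θ => sInf ((fun p => FA (p, θ)) '' {p | FB (p, θ) ≤ 1})) =
      fun θ => FA (p θ, θ) := by
    funext θ
    refine IsLeast.csInf_eq ⟨⟨p θ, hpc θ, rfl⟩, ?_⟩
    rintro _ ⟨x, hx, rfl⟩
    exact hpmin θ x hx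
  rw [hvalue, contDiff_one_iff_hasFDerivAt]
  refine ⟨_, ?_, fun θ => hasFDerivAt_of_lagrangian (hdA _) (hdB _) hpcont.continuousAt
    hlcont.continuousAt hpeq fun t x => ?_⟩
  · exact (hA'.add (hlcont.smul hB')).clm_comp continuous_const
  · have h1 := (hconvA t).add_fderiv_sub_le (hpartial FA hdA (p t) t) x
    have h2 := (hconvB t).add_fderiv_sub_le (hpartial FB hdB (p t) t) x
    simp only [ContinuousLinearMap.comp_apply, ContinuousLinearMap.inl_apply] at h1 h2
    have h3 := mul_le_mul_of_nonneg_left h2 (hl0 t)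
    linarith [hlv t (x - p t)]
end

section
/- Let F_A, F_B : ℝ^n × ℝ^m → ℝ satisfy, for each parameter θ ∈ ℝ^m: p ↦ F_A(p, θ) and p ↦ F_B(p, θ) are convex; the set {p | F_A(p, θ) ≤ 1} is nonempty; there exists p with F_B(p, θ) < 1; the sets {p | F_A(p, θ) ≤ 1} and {p | F_B(p, θ) ≤ 1} are disjoint; at least one of p ↦ F_A(p, θ) and p ↦ F_B(p, θ) has an everywhere positive definite Hessian in p; and the minimum of p ↦ F_A(p, θ) over {p | F_B(p, θ) ≤ 1} is attained. If, in addition, F_A and F_B are of class C^{k+1} (jointly in p and θ) for some integer k ≥ 1, then the optimal-value function α⋆(θ) = min { F_A(p, θ) | F_B(p, θ) ≤ 1 } is of class C^k in θ on ℝ^m. -/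
open Set Filter Topology

section Convex

variable {E : Type*} [NormedAddCommGroup E] [NormedSpace ℝ E]

/-- A convex function lies above its tangent hyperplanes. -/
theorem ConvexOn.add_hasFDerivAt_le {f : E → ℝ} {f' : E →L[ℝ] ℝ} {x : E}
    (hf : ConvexOn ℝ univ f) (hf' : HasFDerivAt f f' x) (y : E) :
    f x + f' (y - x) ≤ f y := by
  have hg : ConvexOn ℝ univ (fun t : ℝ => f (AffineMap.lineMap x y t)) :=
    hf.comp_affineMap (AffineMap.lineMap x y)
  have hd : HasDerivAt (fun t : ℝ => f (AffineMap.lineMap x y t)) (f' (y - x)) 0 := by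
    refine HasFDerivAt.comp_hasDerivAt (0 : ℝ) ?_ AffineMap.hasDerivAt_lineMap
    simpa using hf'
  have := hg.le_slope_of_hasDerivAt (mem_univ 0) (mem_univ 1) one_pos hd
  simp [slope_def_field, -map_sub] at this
  linarith

/-- The second derivative of a convex function is positive semidefinite. -/
theorem ConvexOn.hasFDerivAt_fderiv_nonneg {f : E → ℝ} {f'' : E →L[ℝ] E →L[ℝ] ℝ} {x : E}
    (hf : ConvexOn ℝ univ f) (hd : Differentiable ℝ f) (hf'' : HasFDerivAt (fderiv ℝ f) f'' x)
    (v : E) : 0 ≤ f'' v v := by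
  have hmin : IsLocalMinOn (fun y => fderiv ℝ f y v) (segment ℝ x (x + v)) x := by
    refine IsMinOn.localize fun y hy => ?_
    rw [segment_eq_image'] at hy
    obtain ⟨t, ⟨ht, -⟩, rfl⟩ := hy
    rcases ht.eq_or_lt with rfl | ht
    · simp
    have h₁ := hf.add_hasFDerivAt_le (hd x).hasFDerivAt (x + t • v)
    have h₂ := hf.add_hasFDerivAt_le (hd (x + t • v)).hasFDerivAt x
    simp only [add_sub_cancel_left, sub_add_cancel_left, map_neg, map_smul, smul_eq_mul] at h₁ h₂ ⊢
    have h : t * fderiv ℝ f x v ≤ t * fderiv ℝ f (x + t • v) v := by linarith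
    exact le_of_mul_le_mul_left h ht
  have hderiv : HasFDerivAt (fun y => fderiv ℝ f y v)
      ((ContinuousLinearMap.apply ℝ ℝ v).comp f'') x :=
    (ContinuousLinearMap.apply ℝ ℝ v).hasFDerivAt.comp x hf''
  simpa using hmin.hasFDerivWithinAt_nonneg hderiv.hasFDerivWithinAt
    (mem_posTangentConeAt_of_segment_subset Subset.rfl)

/-- Karush-Kuhn-Tucker conditions at a minimizer of a convex program with a single constraint
satisfying Slater's condition, when the minimizer of the program is not a global minimizer of `f`:
the constraint is active and its multiplier is positive. -/
theorem ConvexOn.exists_pos_multiplier [CompleteSpace E] {f g : E → ℝ} {f' g' : E →L[ℝ] ℝ}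
    {x q s : E} {c : ℝ} (hf : ConvexOn ℝ univ f) (hg : ConvexOn ℝ univ g)
    (hf' : HasStrictFDerivAt f f' x) (hg' : HasStrictFDerivAt g g' x)
    (hx : g x ≤ c) (hmin : ∀ y, g y ≤ c → f x ≤ f y) (hq : f q < f x) (hs : g s < c) :
    g x = c ∧ ∃ l : ℝ, 0 < l ∧ f' + l • g' = 0 := by
  have hf'0 : f' ≠ 0 := by
    rintro rfl
    have := hf.add_hasFDerivAt_le hf'.hasFDerivAt q
    simp at this
    linarith
  have hgx : g x = c := by
    by_contra hne
    have hlt : ∀ᶠ y in 𝓝 x, g y < c :=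
      hg'.hasFDerivAt.continuousAt.eventually_lt_const (lt_of_le_of_ne hx hne)
    have hloc : IsLocalMin f x := hlt.mono fun y hy => hmin y hy.le
    exact hf'0 (hloc.hasFDerivAt_eq_zero hf'.hasFDerivAt)
  have hg's : g' (s - x) < 0 := by
    have := hg.add_hasFDerivAt_le hg'.hasFDerivAt s
    linarith
  have hf's : 0 ≤ f' (s - x) := by
    have hloc : IsLocalMinOn f {y | g y ≤ c} x := IsMinOn.localize fun y hy => hmin y hy
    have hconv : Convex ℝ {y | g y ≤ c} := by simpa using hg.convex_le c
    exact hloc.hasFDerivWithinAt_nonneg hf'.hasFDerivAt.hasFDerivWithinAt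
      (sub_mem_posTangentConeAt_of_segment_subset (hconv.segment_subset hx hs.le))
  have hextr : IsLocalExtrOn f {y | g y = g x} x :=
    Or.inl (IsMinOn.localize fun y hy => hmin y (by rw [mem_ofPred_eq] at hy; linarith))
  obtain ⟨a, b, hab, h⟩ := hextr.exists_multipliers_of_hasStrictFDerivAt_1d hg' hf'
  have hb : b ≠ 0 := by
    rintro rfl
    have ha : a ≠ 0 := by simpa using hab
    have := DFunLike.congr_fun h (s - x)
    simp [ha, -map_sub] at this
    exact hg's.ne this
  have hl : f' + (a / b) • g' = 0 := by
    have := congrArg (fun z => b⁻¹ • z) h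
    simp only [smul_add, smul_smul, inv_mul_cancel₀ hb, one_smul, smul_zero] at this
    rw [add_comm, div_eq_inv_mul, this]
  refine ⟨hgx, a / b, lt_of_le_of_ne ?_ ?_, hl⟩
  · have := DFunLike.congr_fun hl (s - x)
    simp [-map_sub] at this
    by_contra! hneg
    have := mul_pos_of_neg_of_neg hneg hg's
    linarith
  · intro h0
    rw [← h0] at hl
    simp [hf'0] at hl

/-- Sufficiency of the Karush-Kuhn-Tucker conditions for a convex program. -/
theorem ConvexOn.isLeast_of_multiplier {f g : E → ℝ} {f' g' : E →L[ℝ] ℝ} {x : E} {c l : ℝ}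
    (hf : ConvexOn ℝ univ f) (hg : ConvexOn ℝ univ g)
    (hf' : HasFDerivAt f f' x) (hg' : HasFDerivAt g g' x)
    (hx : g x = c) (hl : 0 ≤ l) (h : f' + l • g' = 0) :
    IsLeast (f '' {y | g y ≤ c}) (f x) := by
  refine ⟨mem_image_of_mem f hx.le, ?_⟩
  rintro _ ⟨y, hy, rfl⟩
  have h₁ := hf.add_hasFDerivAt_le hf' y
  have h₂ := hg.add_hasFDerivAt_le hg' y
  have h₃ := DFunLike.congr_fun h (y - x)
  simp [-map_sub] at h₃
  have h₄ : l * g' (y - x) ≤ 0 :=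
    mul_nonpos_of_nonneg_of_nonpos hl (by rw [mem_ofPred_eq] at hy; linarith)
  linarith

end Convex

section PartialDerivative

variable {E T : Type*} [NormedAddCommGroup E] [NormedSpace ℝ E]
  [NormedAddCommGroup T] [NormedSpace ℝ T]

/-- The partial derivative of `F` with respect to its first argument. -/
noncomputable def fderivFst (F : E × T → ℝ) (z : E × T) : E →L[ℝ] ℝ :=
  (fderiv ℝ F z).comp (ContinuousLinearMap.inl ℝ E T)

theorem ContDiff.fderivFst {F : E × T → ℝ} {k : ℕ} (hF : ContDiff ℝ (k + 1 : ℕ) F) :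
    ContDiff ℝ k (fderivFst F) :=
  (hF.fderiv_right (by norm_cast)).clm_comp contDiff_const

theorem hasStrictFDerivAt_fderivFst {F : E × T → ℝ} {k : ℕ} (hF : ContDiff ℝ (k + 1 : ℕ) F)
    (p : E) (t : T) : HasStrictFDerivAt (fun x => F (x, t)) (fderivFst F (p, t)) p :=
  (hF.contDiffAt.hasStrictFDerivAt (by simp)).comp p
    (f := fun x => (x, t)) ((hasStrictFDerivAt_id p).prodMk (hasStrictFDerivAt_const t p))

theorem fderiv_eq_fderivFst {F : E × T → ℝ} {k : ℕ} (hF : ContDiff ℝ (k + 1 : ℕ) F) (t : T) :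
    fderiv ℝ (fun x => F (x, t)) = fun x => fderivFst F (x, t) :=
  funext fun p => (hasStrictFDerivAt_fderivFst hF p t).hasFDerivAt.fderiv

theorem hasFDerivAt_fderiv_slice {F : E × T → ℝ} {k : ℕ} (hk : 1 ≤ k)
    (hF : ContDiff ℝ (k + 1 : ℕ) F) (p : E) (t : T) :
    HasFDerivAt (fderiv ℝ (fun x => F (x, t)))
      ((fderiv ℝ (fderivFst F) (p, t)).comp (ContinuousLinearMap.inl ℝ E T)) p := by
  rw [fderiv_eq_fderivFst hF]
  have hk0 : ((k : ℕ) : WithTop ℕ∞) ≠ 0 := by exact_mod_cast (by omega : k ≠ 0)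
  exact (hF.fderivFst.contDiffAt.hasStrictFDerivAt hk0).hasFDerivAt.comp p
    (f := fun x => (x, t)) (hasFDerivAt_prodMk_left p t)

theorem iteratedFDeriv_two_slice {F : E × T → ℝ} {k : ℕ} (hk : 1 ≤ k)
    (hF : ContDiff ℝ (k + 1 : ℕ) F) (p v : E) (t : T) :
    iteratedFDeriv ℝ 2 (fun x => F (x, t)) p ![v, v] =
      fderiv ℝ (fderivFst F) (p, t) (v, 0) v := by
  rw [iteratedFDeriv_two_apply, (hasFDerivAt_fderiv_slice hk hF p t).fderiv]
  simp

theorem fderiv_fderivFst_nonneg {F : E × T → ℝ} {k : ℕ} (hk : 1 ≤ k)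
    (hF : ContDiff ℝ (k + 1 : ℕ) F) {t : T} (hconv : ConvexOn ℝ univ (fun x => F (x, t)))
    (p v : E) : 0 ≤ fderiv ℝ (fderivFst F) (p, t) (v, 0) v := by
  simpa using hconv.hasFDerivAt_fderiv_nonneg
    (fun x => (hasStrictFDerivAt_fderivFst hF x t).hasFDerivAt.differentiableAt)
    (hasFDerivAt_fderiv_slice hk hF p t) v

/-- The Karush-Kuhn-Tucker map of the parametric program
`min FA (p, t)` subject to `FB (p, t) ≤ c` with active constraint. -/
noncomputable def kktMap (FA FB : E × T → ℝ) (z : T × (E × ℝ)) : (E →L[ℝ] ℝ) × ℝ :=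
  (fderivFst FA (z.2.1, z.1) + z.2.2 • fderivFst FB (z.2.1, z.1), FB (z.2.1, z.1))

theorem contDiff_kktMap {FA FB : E × T → ℝ} {k : ℕ} (hFA : ContDiff ℝ (k + 1 : ℕ) FA)
    (hFB : ContDiff ℝ (k + 1 : ℕ) FB) : ContDiff ℝ k (kktMap FA FB) := by
  have hA := hFA.fderivFst
  have hB := hFB.fderivFst
  have hB' : ContDiff ℝ k FB := hFB.of_le (by norm_cast; omega)
  unfold kktMap
  fun_prop

theorem fderiv_kktMap_inr {FA FB : E × T → ℝ} {k : ℕ} (hk : 1 ≤ k)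
    (hFA : ContDiff ℝ (k + 1 : ℕ) FA) (hFB : ContDiff ℝ (k + 1 : ℕ) FB)
    (t : T) (p v : E) (l w : ℝ) :
    fderiv ℝ (kktMap FA FB) (t, (p, l)) (0, (v, w)) =
      (fderiv ℝ (fderivFst FA) (p, t) (v, 0) + l • fderiv ℝ (fderivFst FB) (p, t) (v, 0)
        + w • fderivFst FB (p, t), fderivFst FB (p, t) v) := by
  have hk0 : ((k : ℕ) : WithTop ℕ∞) ≠ 0 := by exact_mod_cast (by omega : k ≠ 0)
  let ι : T × (E × ℝ) →L[ℝ] E × T :=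
    ((ContinuousLinearMap.fst ℝ E ℝ).comp (ContinuousLinearMap.snd ℝ T (E × ℝ))).prod
      (ContinuousLinearMap.fst ℝ T (E × ℝ))
  let μ : T × (E × ℝ) →L[ℝ] ℝ :=
    (ContinuousLinearMap.snd ℝ E ℝ).comp (ContinuousLinearMap.snd ℝ T (E × ℝ))
  have hι : HasFDerivAt ι ι (t, (p, l)) := ι.hasFDerivAt
  have hA : HasFDerivAt (fun z => fderivFst FA (ι z)) ((fderiv ℝ (fderivFst FA) (p, t)).comp ι)
      (t, (p, l)) :=
    HasFDerivAt.comp (t, (p, l)) (f := ι) ((hFA.fderivFst.differentiable hk0) (p, t)).hasFDerivAt hι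
  have hB : HasFDerivAt (fun z => fderivFst FB (ι z)) ((fderiv ℝ (fderivFst FB) (p, t)).comp ι)
      (t, (p, l)) :=
    HasFDerivAt.comp (t, (p, l)) (f := ι) ((hFB.fderivFst.differentiable hk0) (p, t)).hasFDerivAt hι
  have hB' : HasFDerivAt (fun z => FB (ι z)) ((fderiv ℝ FB (p, t)).comp ι)
      (t, (p, l)) :=
    HasFDerivAt.comp (t, (p, l)) (f := ι) ((hFB.differentiable (by simp)) (p, t)).hasFDerivAt hι
  have h : HasFDerivAt (kktMap FA FB) _ (t, (p, l)) :=
    (hA.add (μ.hasFDerivAt.smul hB)).prodMk hB'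
  rw [h.fderiv]
  simp [ι, μ, fderivFst, add_assoc]

theorem isInvertible_fderiv_kktMap [FiniteDimensional ℝ E] {FA FB : E × T → ℝ} {k : ℕ}
    (hk : 1 ≤ k) (hFA : ContDiff ℝ (k + 1 : ℕ) FA) (hFB : ContDiff ℝ (k + 1 : ℕ) FB)
    {t : T} {p : E} {l : ℝ} (hB : fderivFst FB (p, t) ≠ 0)
    (hpos : ∀ v, v ≠ 0 → 0 < fderiv ℝ (fderivFst FA) (p, t) (v, 0) v +
      l * fderiv ℝ (fderivFst FB) (p, t) (v, 0) v) :
    (fderiv ℝ (kktMap FA FB) (t, (p, l)) ∘L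
      ContinuousLinearMap.inr ℝ T (E × ℝ)).IsInvertible := by
  set L := fderiv ℝ (kktMap FA FB) (t, (p, l)) ∘L ContinuousLinearMap.inr ℝ T (E × ℝ) with hL
  have hinj : Function.Injective L := by
    rw [injective_iff_map_eq_zero]
    rintro ⟨v, w⟩ h
    rw [hL, ContinuousLinearMap.comp_apply, ContinuousLinearMap.inr_apply,
      fderiv_kktMap_inr hk hFA hFB, Prod.mk_eq_zero] at h
    obtain ⟨h₁, h₂⟩ := h
    have hv : v = 0 := by
      by_contra hv
      have := DFunLike.congr_fun h₁ v
      simp [h₂] at this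
      exact (hpos v hv).ne' this
    subst hv
    have hw : w = 0 := by simpa [hB, ← Prod.zero_eq_mk] using h₁
    simp [hw]
  have hrank : Module.finrank ℝ (E × ℝ) = Module.finrank ℝ ((E →L[ℝ] ℝ) × ℝ) := by
    rw [Module.finrank_prod, Module.finrank_prod,
      ← (LinearMap.toContinuousLinearMap : (E →ₗ[ℝ] ℝ) ≃ₗ[ℝ] (E →L[ℝ] ℝ)).finrank_eq]
    simp
  let e := (LinearEquiv.ofInjectiveOfFinrankEq (L : E × ℝ →ₗ[ℝ] (E →L[ℝ] ℝ) × ℝ) hinj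
    hrank).toContinuousLinearEquiv
  exact ⟨e, by ext x <;> rfl⟩

/-- The optimal value of a parametric convex program depends smoothly on the parameter near a
parameter at which the Karush-Kuhn-Tucker conditions hold with a positive multiplier and a
positive definite Hessian of the Lagrangian. -/
theorem contDiffAt_sInf_of_kkt [FiniteDimensional ℝ E] [CompleteSpace T] {FA FB : E × T → ℝ}
    {k : ℕ} (hk : 1 ≤ k) (hconvA : ∀ t, ConvexOn ℝ univ (fun p => FA (p, t)))
    (hconvB : ∀ t, ConvexOn ℝ univ (fun p => FB (p, t)))
    (hFA : ContDiff ℝ (k + 1 : ℕ) FA) (hFB : ContDiff ℝ (k + 1 : ℕ) FB)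
    {t : T} {p : E} {l c : ℝ} (hl : 0 < l) (hp : FB (p, t) = c)
    (hkkt : fderivFst FA (p, t) + l • fderivFst FB (p, t) = 0)
    (hB : fderivFst FB (p, t) ≠ 0)
    (hpos : ∀ v, v ≠ 0 → 0 < fderiv ℝ (fderivFst FA) (p, t) (v, 0) v +
      l * fderiv ℝ (fderivFst FB) (p, t) (v, 0) v) :
    ContDiffAt ℝ k (fun s => sInf ((fun x => FA (x, s)) '' {x | FB (x, s) ≤ c})) t := by
  have : CompleteSpace E := FiniteDimensional.complete ℝ E
  have hk0 : ((k : ℕ) : WithTop ℕ∞) ≠ 0 := by exact_mod_cast (by omega : k ≠ 0)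
  have hcd : ContDiffAt ℝ k (kktMap FA FB) (t, (p, l)) := (contDiff_kktMap hFA hFB).contDiffAt
  have hinv := isInvertible_fderiv_kktMap hk hFA hFB hB hpos
  set ψ := hcd.implicitFunction hk0 hinv
  have hψ : ContDiffAt ℝ k ψ t := hcd.contDiffAt_implicitFunction hk0 hinv
  have hψt : ψ t = (p, l) := hcd.implicitFunction_apply_self hk0 hinv
  have hψpos : ∀ᶠ s in 𝓝 t, 0 < (ψ s).2 :=
    (continuousAt_snd.comp hψ.continuousAt).eventually_const_lt (by simpa [hψt] using hl)
  have hψeq : ∀ᶠ s in 𝓝 t, kktMap FA FB (s, ψ s) = kktMap FA FB (t, (p, l)) :=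
    hcd.eventually_apply_implicitFunction hk0 hinv
  have hFA' : ContDiff ℝ k FA := hFA.of_le (by norm_cast; omega)
  have hval : ContDiffAt ℝ k (fun s => FA ((ψ s).1, s)) t :=
    hFA'.contDiffAt.comp t (hψ.fst.prodMk contDiffAt_id)
  refine hval.congr_of_eventuallyEq ?_
  filter_upwards [hψpos, hψeq] with s hs hs'
  simp only [kktMap, hkkt, hp, Prod.mk.injEq] at hs'
  exact ((hconvA s).isLeast_of_multiplier (hconvB s)
    (hasStrictFDerivAt_fderivFst hFA _ s).hasFDerivAt
    (hasStrictFDerivAt_fderivFst hFB _ s).hasFDerivAt hs'.2 hs.le hs'.1).csInf_eq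

end PartialDerivative

/-- If the scaling functions are of class `C^{k+1}` (k ≥ 1), the
minimal scaling factor `α⋆(θ)` is of class `C^k` in the parameter `θ`. -/
theorem stmt_4 {n m : ℕ} (k : ℕ) (hk : 1 ≤ k)
    (FA FB : EuclideanSpace ℝ (Fin n) × EuclideanSpace ℝ (Fin m) → ℝ)
    (hconvA : ∀ θ, ConvexOn ℝ Set.univ (fun p => FA (p, θ)))
    (hconvB : ∀ θ, ConvexOn ℝ Set.univ (fun p => FB (p, θ)))
    (hAne : ∀ θ, ∃ p, FA (p, θ) ≤ 1)
    (hSlater : ∀ θ, ∃ p, FB (p, θ) < 1)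
    (hdisj : ∀ θ p, ¬(FA (p, θ) ≤ 1 ∧ FB (p, θ) ≤ 1))
    (hHess : ∀ θ,
      (∀ p v, v ≠ 0 → 0 < iteratedFDeriv ℝ 2 (fun p' => FA (p', θ)) p ![v, v]) ∨
      (∀ p v, v ≠ 0 → 0 < iteratedFDeriv ℝ 2 (fun p' => FB (p', θ)) p ![v, v]))
    (hattain : ∀ θ, ∃ p, FB (p, θ) ≤ 1 ∧
      ∀ p', FB (p', θ) ≤ 1 → FA (p, θ) ≤ FA (p', θ))
    (hFA : ContDiff ℝ (k + 1 : ℕ) FA) (hFB : ContDiff ℝ (k + 1 : ℕ) FB) :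
    ContDiff ℝ (k : ℕ) (fun θ => sInf ((fun p => FA (p, θ)) '' {p | FB (p, θ) ≤ 1})) := by
  rw [contDiff_iff_contDiffAt]
  intro θ
  obtain ⟨p, hp, hmin⟩ := hattain θ
  obtain ⟨q, hq⟩ := hAne θ
  obtain ⟨s, hs⟩ := hSlater θ
  have hFAp : 1 < FA (p, θ) := not_le.1 fun h => hdisj θ p ⟨h, hp⟩
  obtain ⟨hp1, l, hl, hkkt⟩ := (hconvA θ).exists_pos_multiplier (hconvB θ)
    (hasStrictFDerivAt_fderivFst hFA p θ) (hasStrictFDerivAt_fderivFst hFB p θ)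
    hp hmin (hq.trans_lt hFAp) hs
  refine contDiffAt_sInf_of_kkt hk hconvA hconvB hFA hFB hl hp1 hkkt ?_ fun v hv => ?_
  · intro h0
    have := (hconvB θ).add_hasFDerivAt_le (hasStrictFDerivAt_fderivFst hFB p θ).hasFDerivAt s
    simp only [h0, zero_apply] at this
    linarith
  · have hA := fderiv_fderivFst_nonneg hk hFA (hconvA θ) p v
    have hB := fderiv_fderivFst_nonneg hk hFB (hconvB θ) p v
    rcases hHess θ with h | h
    · have := h p v hv
      rw [iteratedFDeriv_two_slice hk hFA] at this
      exact add_pos_of_pos_of_nonneg this (mul_nonneg hl.le hB)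
    · have := h p v hv
      rw [iteratedFDeriv_two_slice hk hFB] at this
      exact add_pos_of_nonneg_of_pos hA (mul_pos hl this)
end

section
/- Consider the control-affine system ẋ = f(x) + g(x)u with state x ∈ ℝ^n and control u ∈ ℝ^q, where f : ℝ^n → ℝ^n and g : ℝ^n → ℝ^{n×q}. Let h : ℝ^n → ℝ and let Γ_1, …, Γ_m : [0, ∞) → [0, ∞) be continuous strictly increasing functions with Γ_i(0) = 0. Define ψ_0 = h, and for i = 1, …, m−1, ψ_i(x) = Dψ_{i−1}(x)[f(x)] + Γ_i(ψ_{i−1}(x)), and ψ_m(x, u) = Dψ_{m−1}(x)[f(x) + g(x)u] + Γ_m(ψ_{m−1}(x)), where each ψ_i (i ≤ m−1) is assumed differentiable. Assume the relative-degree condition: Dψ_j(x)[g(x)u] = 0 for all x ∈ ℝ^n, all u ∈ ℝ^q, and all j = 0, …, m−2. Suppose (x_e, u_e) is an equilibrium, i.e., f(x_e) + g(x_e)u_e = 0, that ψ_i(x_e) ≥ 0 for i = 0, …, m−1, and that u_e is a minimizer of u ↦ ‖u − u_n(x_e)‖₂² over the set {u ∈ ℝ^q | ψ_m(x_e, u)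 ≥ 0}, where u_n(x_e) ∈ ℝ^q is a given nominal control. Then at least one of the following holds: (i) u_e = u_n(x_e); (ii) h(x_e) = 0. -/
/-- A point of a half-space with positive slack that is a nearest point of the half-space to `b`
must be `b` itself. -/
theorem eq_of_forall_norm_sub_le_of_slack {E : Type*} [NormedAddCommGroup E] [NormedSpace ℝ E]
    (ℓ : E →ₗ[ℝ] ℝ) {s : ℝ} (hs : 0 < s) {a b : E}
    (hmin : ∀ u, 0 ≤ s + ℓ (u - a) → ‖a - b‖ ≤ ‖u - b‖) : a = b := by
  by_contra hab
  have hnorm : 0 < ‖a - b‖ := norm_pos_iff.mpr (sub_ne_zero.mpr hab)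
  set c := ℓ (b - a)
  have hden : 0 < s + |c| := by positivity
  set t := s / (s + |c|) with ht
  have ht0 : 0 < t := by positivity
  have ht1 : t ≤ 1 := (div_le_one hden).mpr (by linarith [abs_nonneg c])
  have htc : t * (s + |c|) = s := div_mul_cancel₀ s hden.ne'
  have hle := hmin (a + t • (b - a)) (by
    rw [add_sub_cancel_left, map_smul, smul_eq_mul]
    change 0 ≤ s + t * c
    nlinarith [neg_abs_le c])
  have hseg : a + t • (b - a) - b = (1 - t) • (a - b) := by module
  rw [hseg, norm_smul, Real.norm_of_nonneg (by linarith)] at hle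
  nlinarith

/-- Any equilibrium of the closed-loop system under the HOCBF-QP
controller either coincides with the nominal control or lies on the boundary
of the safe set (`h(x_e) = 0`). -/
theorem stmt_7 {n q : ℕ} (m : ℕ) (hm : 1 ≤ m)
    (f : EuclideanSpace ℝ (Fin n) → EuclideanSpace ℝ (Fin n))
    (g : EuclideanSpace ℝ (Fin n) → (EuclideanSpace ℝ (Fin q) →L[ℝ] EuclideanSpace ℝ (Fin n)))
    (h : EuclideanSpace ℝ (Fin n) → ℝ)
    -- the class-K functions Γ_1, ..., Γ_m on [0, ∞)
    (Γ : ℕ → ℝ → ℝ)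
    (hΓmono : ∀ i, 1 ≤ i → i ≤ m → StrictMonoOn (Γ i) (Set.Ici (0 : ℝ)))
    (hΓcont : ∀ i, 1 ≤ i → i ≤ m → ContinuousOn (Γ i) (Set.Ici (0 : ℝ)))
    (hΓzero : ∀ i, 1 ≤ i → i ≤ m → Γ i 0 = 0)
    (hΓnonneg : ∀ i, 1 ≤ i → i ≤ m → ∀ t : ℝ, 0 ≤ t → 0 ≤ Γ i t)
    -- the intermediate barrier functions ψ_0, ..., ψ_{m-1} and ψ_m
    (ψ : ℕ → EuclideanSpace ℝ (Fin n) → ℝ)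
    (ψm : EuclideanSpace ℝ (Fin n) → EuclideanSpace ℝ (Fin q) → ℝ)
    (hψdiff : ∀ i, i ≤ m - 1 → Differentiable ℝ (ψ i))
    (hψzero : ψ 0 = h)
    (hψrec : ∀ i, 1 ≤ i → i ≤ m - 1 → ∀ x,
      ψ i x = fderiv ℝ (ψ (i - 1)) x (f x) + Γ i (ψ (i - 1) x))
    (hψm : ∀ x u, ψm x u = fderiv ℝ (ψ (m - 1)) x (f x + g x u) + Γ m (ψ (m - 1) x))
    -- relative-degree condition
    (hreldeg : ∀ x u j, j + 2 ≤ m → fderiv ℝ (ψ j) x (g x u) = 0)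
    -- the equilibrium, safe-set membership, and optimality of u_e in the QP
    (xe : EuclideanSpace ℝ (Fin n)) (ue un : EuclideanSpace ℝ (Fin q))
    (heq : f xe + g xe ue = 0)
    (hsafe : ∀ i, i ≤ m - 1 → 0 ≤ ψ i xe)
    (hfeas : 0 ≤ ψm xe ue)
    (hmin : ∀ u, 0 ≤ ψm xe u → ‖ue - un‖ ≤ ‖u - un‖) :
    ue = un ∨ h xe = 0 := by
  subst hψzero
  rw [or_iff_not_imp_right]
  intro hne
  have hΓpos : ∀ i, 1 ≤ i → i ≤ m → ∀ t, 0 < t → 0 < Γ i t := fun i h1 hi t ht => by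
    simpa [hΓzero i h1 hi] using hΓmono i h1 hi Set.self_mem_Ici ht.le ht
  have hdrift : ∀ j, j + 2 ≤ m → fderiv ℝ (ψ j) xe (f xe) = 0 := fun j hj => by
    rw [eq_neg_of_add_eq_zero_left heq, map_neg, hreldeg xe ue j hj, neg_zero]
  have hψpos : ∀ i, i ≤ m - 1 → 0 < ψ i xe := by
    intro i
    induction i with
    | zero => exact fun hi => lt_of_le_of_ne (hsafe 0 hi) (Ne.symm hne)
    | succ k ih =>
      intro hk
      rw [hψrec (k + 1) (by omega) hk, Nat.add_sub_cancel, hdrift k (by omega), zero_add]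
      exact hΓpos (k + 1) (by omega) (by omega) _ (ih (by omega))
  refine eq_of_forall_norm_sub_le_of_slack
    ((fderiv ℝ (ψ (m - 1)) xe).comp (g xe)).toLinearMap
    (hΓpos m hm le_rfl _ (hψpos (m - 1) le_rfl)) fun u hu => hmin u ?_
  have hshift : f xe + g xe u = g xe (u - ue) := by
    rw [eq_neg_of_add_eq_zero_left heq, map_sub]
    abel
  rw [hψm, hshift, add_comm]
  exact hu
end
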